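/- Let n ≥ 1, let c be a nonnegative integer or half-integer (so 2c ∈ ℕ), and let p be a nonnegative integer with p ≤ 2c. Then, as an identity of rational functions (in y_1,…,y_n with x_j = y_j^2 if c is a half-integer), so_{2n}((c^{n−1}, c−p); x^{±1}) = (x_1 x_2 ⋯ x_n)^{−c} · Σ_ν s_n(ν; x), where the sum ranges over all partitions ν ⊆ ((2c)^n) with oddcols(((2c)^n)/ν) = p. -/

import Mathlib

open scoped Classical
open Finset

noncomputable section

/-- Complete homogeneous symmetric polynomial of degree `m` in the variables `x`
(`0` for negative `m`). -/
def hpoly {R : Type} [CommRing R] {N : ℕ} (x : Fin N → R) (m : ℤ) : R :=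
  if 0 ≤ m then
    ∑ f ∈ Finset.univ.filter (fun f : Fin m.toNat → Fin N => Monotone f), ∏ i, x (f i)
  else 0

/-- The Schur function `s(λ; x) = det(h_{λ_i-i+j})` (indices `1 ≤ i,j ≤ r`). -/
def schur {R : Type} [CommRing R] {N r : ℕ} (lam : Fin r → ℤ) (x : Fin N → R) : R :=
  Matrix.det (Matrix.of fun i j : Fin r =>
    hpoly x (lam i - ((i : ℕ) : ℤ) + ((j : ℕ) : ℤ)))

/-- The field of rational functions in `n` variables over `ℚ`. -/
abbrev FF (n : ℕ) : Type := FractionRing (MvPolynomial (Fin n) ℚ)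

/-- The variables, as elements of the rational function field. -/
def Xv (n : ℕ) : Fin n → FF n := fun i =>
  algebraMap (MvPolynomial (Fin n) ℚ) (FF n) (MvPolynomial.X i)

/-- Irreducible even orthogonal character `so_{2n}(λ; x^{±1})`, written in the
variables `y` where `x_j = y_j²`; here `L` is the doubled index, `L = 2λ`. -/
def soEven {F : Type} [Field F] (n : ℕ) (L : Fin n → ℤ) (y : Fin n → F) : F :=
  (Matrix.det (Matrix.of fun i j : Fin n =>
      y j ^ (L i + 2 * (n : ℤ) - 2 * ((i : ℕ) : ℤ) - 2) +
        y j ^ (-(L i + 2 * (n : ℤ) - 2 * ((i : ℕ) : ℤ) - 2))) +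
   Matrix.det (Matrix.of fun i j : Fin n =>
      y j ^ (L i + 2 * (n : ℤ) - 2 * ((i : ℕ) : ℤ) - 2) -
        y j ^ (-(L i + 2 * (n : ℤ) - 2 * ((i : ℕ) : ℤ) - 2)))) /
  Matrix.det (Matrix.of fun i j : Fin n =>
    y j ^ (2 * (n : ℤ) - 2 * ((i : ℕ) : ℤ) - 2) +
      y j ^ (-(2 * (n : ℤ) - 2 * ((i : ℕ) : ℤ) - 2)))

/-- The number of odd columns of the skew shape `(C^n)/ν`. -/
def oddColsCount {n : ℕ} (C : ℕ) (ν : Fin n → ℕ) : ℕ :=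
  ((Finset.range C).filter
    (fun j => Odd ((Finset.univ.filter (fun i : Fin n => ν i < j + 1)).card))).card



lemma lag_aux {F : Type} [Field F] [CharZero F] (S : Finset F) (h0 : (0 : F) ∉ S)
    (h1 : (1 : F) ∉ S) (h2 : (-1 : F) ∉ S) (P : Polynomial F) (hP : P.natDegree < S.card + 2) :
    P.eval 0 / (-(∏ b ∈ S, (0 - b))) + P.eval 1 / (2 * ∏ b ∈ S, (1 - b))
      + P.eval (-1) / (2 * ∏ b ∈ S, (-1 - b))
      + ∑ a ∈ S, P.eval a / (a * (a - 1) * (a + 1) * ∏ b ∈ S.erase a, (a - b)) = 0 := by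
  have n1 : (1 : F) ≠ -1 := by
    intro h
    have : (2 : F) = 0 := by linear_combination h
    exact two_ne_zero this
  have m2 : (-1 : F) ∉ S := h2
  have m1 : (1 : F) ∉ insert (-1 : F) S := by simp [h1, n1]
  have m0 : (0 : F) ∉ insert (1 : F) (insert (-1 : F) S) := by simp [h0]
  have key := Lagrange.coeff_eq_sum (s := insert (0 : F) (insert 1 (insert (-1) S)))
    (v := id) (Function.injective_id.injOn) (P := P) (by
      rw [card_insert_of_notMem m0, card_insert_of_notMem m1, card_insert_of_notMem m2]
      refine lt_of_le_of_lt Polynomial.degree_le_natDegree ?_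
      norm_cast
      omega)
  rw [card_insert_of_notMem m0, card_insert_of_notMem m1, card_insert_of_notMem m2,
    Polynomial.coeff_eq_zero_of_natDegree_lt (by omega), sum_insert m0, sum_insert m1,
    sum_insert m2] at key
  refine Eq.trans ?_ key.symm
  have e0 : (insert (0 : F) (insert 1 (insert (-1) S))).erase 0 = insert 1 (insert (-1) S) :=
    erase_insert m0
  have e1 : (insert (0 : F) (insert 1 (insert (-1) S))).erase 1 = insert 0 (insert (-1) S) := by
    rw [Finset.erase_insert_of_ne (by simp), erase_insert m1]
  have e2 : (insert (0 : F) (insert 1 (insert (-1) S))).erase (-1) = insert 0 (insert 1 S) := by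
    rw [Finset.erase_insert_of_ne (by simp), Finset.erase_insert_of_ne n1, erase_insert m2]
  simp only [id]
  rw [e0, e1, e2, prod_insert m1, prod_insert m2, prod_insert (by simp [h0]), prod_insert m2,
    prod_insert (by simp [h0]), prod_insert h1]
  rw [← add_assoc, ← add_assoc]
  congr 1
  · congr 1
    · congr 1
      · congr 1
        ring
      · congr 1
        ring
    · congr 1
      ring
  · refine sum_congr rfl fun a ha => ?_
    have a0 : a ≠ 0 := fun h => h0 (h ▸ ha)
    have a1 : a ≠ 1 := fun h => h1 (h ▸ ha)
    have a2 : a ≠ -1 := fun h => h2 (h ▸ ha)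
    rw [Finset.erase_insert_of_ne a0.symm, Finset.erase_insert_of_ne a1.symm,
      Finset.erase_insert_of_ne a2.symm, prod_insert (by simp [h0]), prod_insert (by simp [h1, n1]),
      prod_insert (by simp [h2])]
    congr 1
    ring

lemma natDegree_prod_aux {F : Type} [Field F] (S : Finset F) :
    (∏ b ∈ S, (1 - Polynomial.C b * Polynomial.X)).natDegree ≤ S.card := by
  refine (Polynomial.natDegree_prod_le _ _).trans ?_
  rw [card_eq_sum_ones]
  refine sum_le_sum fun b _ => ?_
  compute_degree

/-- The two interpolation identities, for a set of values. -/
lemma AB_set {F : Type} [Field F] [CharZero F] (S : Finset F) (h0 : (0 : F) ∉ S)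
    (hm : ∀ a ∈ S, a * a ≠ 1) (hS : Even S.card) :
    (∑ a ∈ S, ∏ b ∈ S.erase a, (1 - b * a) / (1 - a / b) = 1 - ∏ a ∈ S, a) ∧
    (∑ a ∈ S, a * ∏ b ∈ S.erase a, (1 - b * a) / (1 - a / b) = 0) := by
  have h1 : (1 : F) ∉ S := fun h => hm 1 h (by ring)
  have h2 : (-1 : F) ∉ S := fun h => hm (-1) h (by ring)
  set P : Polynomial F := ∏ b ∈ S, (1 - Polynomial.C b * Polynomial.X) with hP
  have hdeg : P.natDegree ≤ S.card := natDegree_prod_aux S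
  have hev : ∀ t, P.eval t = ∏ b ∈ S, (1 - b * t) := by
    intro t; simp [hP, Polynomial.eval_prod]
  have k0 := lag_aux S h0 h1 h2 P (by omega)
  have k1 := lag_aux S h0 h1 h2 (Polynomial.X * P) (by
    refine lt_of_le_of_lt Polynomial.natDegree_mul_le ?_
    simp; omega)
  have p1 : ∏ b ∈ S, (1 - b) ≠ 0 := prod_ne_zero_iff.2 fun b hb h => h1 (by
    rwa [sub_eq_zero.1 h])
  have p2 : ∏ b ∈ S, (1 + b) ≠ 0 := prod_ne_zero_iff.2 fun b hb h => h2 (by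
    rwa [← eq_neg_of_add_eq_zero_right h])
  have pz : ∏ b ∈ S, b ≠ 0 := prod_ne_zero_iff.2 fun b hb h => h0 (h ▸ hb)
  have q1 : ∏ b ∈ S, (-1 - b) = ∏ b ∈ S, (1 + b) := by
    calc ∏ b ∈ S, (-1 - b) = ∏ b ∈ S, (-(1 + b)) := prod_congr rfl fun b _ => by ring
      _ = _ := by rw [prod_neg, hS.neg_one_pow, one_mul]
  have q0 : ∏ b ∈ S, (0 - b) = ∏ b ∈ S, b := by
    simp only [zero_sub]
    rw [prod_neg, hS.neg_one_pow, one_mul]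
  have term : ∀ a ∈ S, P.eval a / (a * (a - 1) * (a + 1) * ∏ b ∈ S.erase a, (a - b))
      = (∏ b ∈ S, b)⁻¹ * ∏ b ∈ S.erase a, (1 - b * a) / (1 - a / b) := by
    intro a ha
    have a0 : a ≠ 0 := fun h => h0 (h ▸ ha)
    have am := hm a ha
    have a1 : a - 1 ≠ 0 := fun h => h1 (by rw [← sub_eq_zero.1 h]; exact ha)
    have a2 : a + 1 ≠ 0 := fun h => h2 (by rw [← eq_neg_of_add_eq_zero_left h]; exact ha)
    have hc : Odd (S.erase a).card := by
      rw [card_erase_of_mem ha]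
      exact Nat.Even.sub_odd (card_pos.2 ⟨a, ha⟩) hS (by decide)
    have hd : ∏ b ∈ S.erase a, (a - b) ≠ 0 := prod_ne_zero_iff.2 fun b hb h =>
      (mem_erase.1 hb).1 (sub_eq_zero.1 h).symm
    have hz : ∏ b ∈ S.erase a, b ≠ 0 := prod_ne_zero_iff.2 fun b hb h =>
      h0 (h ▸ (mem_erase.1 hb).2)
    have e1 : ∏ b ∈ S.erase a, (1 - b * a) / (1 - a / b)
        = - ((∏ b ∈ S.erase a, (1 - b * a)) * (∏ b ∈ S.erase a, b) / ∏ b ∈ S.erase a, (a - b)) := by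
      have : ∏ b ∈ S.erase a, (1 - b * a) / (1 - a / b)
          = ∏ b ∈ S.erase a, (-(((1 - b * a) * b) / (a - b))) := by
        refine prod_congr rfl fun b hb => ?_
        have b0 : b ≠ 0 := fun h => h0 (h ▸ (mem_erase.1 hb).2)
        have ba : a - b ≠ 0 := fun h => (mem_erase.1 hb).1 (sub_eq_zero.1 h).symm
        have ba' : b - a ≠ 0 := fun h => ba (by linear_combination -h)
        have : 1 - a / b = (b - a) / b := by field_simp
        rw [this]
        field_simp
        ring
      rw [this, prod_neg, hc.neg_one_pow, prod_div_distrib, prod_mul_distrib]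
      ring
    rw [e1, hev, ← mul_prod_erase S _ ha, ← mul_prod_erase S (fun b => b) ha]
    have : 1 - a * a = -((a - 1) * (a + 1)) := by ring
    rw [this]
    field_simp
  have half : (2 : F) ≠ 0 := two_ne_zero
  constructor
  · rw [sum_congr rfl term, ← mul_sum, hev, hev, hev, q0, q1] at k0
    simp only [mul_zero, sub_zero, prod_const_one, mul_one, mul_neg, sub_neg_eq_add] at k0
    generalize (∑ a ∈ S, ∏ b ∈ S.erase a, (1 - b * a) / (1 - a / b)) = T at k0 ⊢
    field_simp at k0
    linear_combination (1 / 2) * k0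
  · have term' : ∀ a ∈ S, (Polynomial.X * P).eval a /
        (a * (a - 1) * (a + 1) * ∏ b ∈ S.erase a, (a - b))
      = (∏ b ∈ S, b)⁻¹ * (a * ∏ b ∈ S.erase a, (1 - b * a) / (1 - a / b)) := by
      intro a ha
      rw [Polynomial.eval_mul, Polynomial.eval_X, mul_div_assoc, term a ha]
      ring
    rw [sum_congr rfl term', ← mul_sum] at k1
    simp only [Polynomial.eval_mul, Polynomial.eval_X, hev, q0, q1, mul_zero, sub_zero,
      mul_one, mul_neg, sub_neg_eq_add, zero_mul, zero_div, one_mul] at k1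
    generalize (∑ a ∈ S, a * ∏ b ∈ S.erase a, (1 - b * a) / (1 - a / b)) = T at k1 ⊢
    field_simp at k1
    linear_combination (1 / 2) * k1

/-- The two interpolation identities, indexed. -/
lemma AB_idx {F : Type} [Field F] [CharZero F] {n : ℕ} (I : Finset (Fin n)) (w : Fin n → F)
    (h0 : ∀ i ∈ I, w i ≠ 0) (hm : ∀ i ∈ I, w i * w i ≠ 1)
    (hi : ∀ i ∈ I, ∀ j ∈ I, w i = w j → i = j) (hS : Even I.card) :
    (∑ a ∈ I, ∏ b ∈ I.erase a, (1 - w b * w a) / (1 - w a / w b) = 1 - ∏ a ∈ I, w a) ∧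
    (∑ a ∈ I, w a * ∏ b ∈ I.erase a, (1 - w b * w a) / (1 - w a / w b) = 0) := by
  have inj : Set.InjOn w I := fun i hi' j hj h => hi i hi' j hj h
  have key := AB_set (I.image w) (by
      intro h
      obtain ⟨i, hi, h⟩ := mem_image.1 h
      exact h0 i hi h) (by
      intro a ha
      obtain ⟨i, hi, rfl⟩ := mem_image.1 ha
      exact hm i hi) (by rw [card_image_of_injOn inj]; exact hS)
  have er : ∀ a ∈ I, (I.image w).erase (w a) = (I.erase a).image w := by
    intro a ha
    ext t
    simp only [mem_erase, mem_image]
    constructor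
    · rintro ⟨h1, i, hi', rfl⟩
      exact ⟨i, ⟨fun h => h1 (by rw [h]), hi'⟩, rfl⟩
    · rintro ⟨i, ⟨h1, h2⟩, rfl⟩
      exact ⟨fun h => h1 (hi _ h2 _ ha h), i, h2, rfl⟩
  have er2 : ∀ a ∈ I, ∏ b ∈ (I.image w).erase (w a), (1 - b * w a) / (1 - w a / b)
      = ∏ b ∈ I.erase a, (1 - w b * w a) / (1 - w a / w b) := by
    intro a ha
    rw [er a ha, prod_image]
    exact fun i hi' j hj h => hi i (mem_erase.1 hi').2 j (mem_erase.1 hj).2 h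
  rw [sum_image inj, sum_image inj, prod_image inj] at key
  rw [sum_congr rfl er2] at key
  refine ⟨key.1, ?_⟩
  rw [← key.2]
  exact sum_congr rfl fun a ha => by rw [er2 a ha]

/-- Lagrange form of the complete homogeneous symmetric functions. -/
def gS {F : Type} [Field F] {n : ℕ} (S : Finset (Fin n)) (z : Fin n → F) (q : ℤ) : F :=
  ∑ k ∈ S, z k ^ (q + S.card - 1) / ∏ l ∈ S.erase k, (z k - z l)

lemma gS_erase {F : Type} [Field F] {n : ℕ} (S : Finset (Fin n)) (z : Fin n → F) (q : ℤ)
    (h0 : ∀ i, z i ≠ 0) (hi : ∀ i ∈ S, ∀ j ∈ S, z i = z j → i = j) (j : Fin n) (hj : j ∈ S) :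
    gS (S.erase j) z q = gS S z q - z j * gS S z (q - 1) := by
  unfold gS
  rw [mul_sum, ← sum_sub_distrib, ← add_sum_erase S _ hj]
  have hc : ((S.erase j).card : ℤ) = S.card - 1 := by
    rw [card_erase_of_mem hj, Nat.cast_sub (card_pos.2 ⟨j, hj⟩)]; simp
  have e0 : z j ^ (q + S.card - 1) = z j * z j ^ (q - 1 + S.card - 1) := by
    rw [← zpow_one_add₀ (h0 j)]; congr 1; ring
  rw [e0, mul_div_assoc, sub_self, zero_add]
  refine sum_congr rfl fun k hk => ?_
  obtain ⟨hkj, hkS⟩ := mem_erase.1 hk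
  have e1 : z k ^ (q + S.card - 1) = z k * z k ^ (q - 1 + S.card - 1) := by
    rw [← zpow_one_add₀ (h0 k)]; congr 1; ring
  have e2 : z k ^ (q + (S.erase j).card - 1) = z k ^ (q - 1 + S.card - 1) := by
    rw [hc]; congr 1; ring
  rw [e1, e2, erase_right_comm, ← mul_prod_erase (S.erase k) (fun l => z k - z l)
    (mem_erase.2 ⟨hkj.symm, hj⟩)]
  have hne : z k - z j ≠ 0 := fun h => hkj (hi _ hkS _ hj (sub_eq_zero.1 h))
  have hd : ∏ l ∈ (S.erase k).erase j, (z k - z l) ≠ 0 := prod_ne_zero_iff.2 fun l hl h => by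
    have := hi _ hkS _ (mem_erase.1 (mem_erase.1 hl).2).2 (sub_eq_zero.1 h)
    exact (mem_erase.1 (mem_erase.1 hl).2).1 this.symm
  field_simp
  

lemma gS_low {F : Type} [Field F] {n : ℕ} (S : Finset (Fin n)) (z : Fin n → F) (q : ℤ)
    (hi : ∀ i ∈ S, ∀ j ∈ S, z i = z j → i = j) (hS : 0 < S.card)
    (h1 : -((S.card : ℤ) - 1) ≤ q) (h2 : q ≤ 0) :
    gS S z q = if q = 0 then 1 else 0 := by
  obtain ⟨e, he⟩ := Int.eq_ofNat_of_zero_le (a := q + S.card - 1) (by omega)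
  have key := Lagrange.coeff_eq_sum (s := S) (v := z) (fun i hi' j hj h => hi i hi' j hj h)
    (P := (Polynomial.X : Polynomial F) ^ e) (by
      rw [Polynomial.degree_X_pow]; norm_cast; omega)
  unfold gS
  simp only [he, zpow_natCast]
  simp only [Polynomial.eval_pow, Polynomial.eval_X, Polynomial.coeff_X_pow] at key
  rw [← key]
  congr 1
  simp only [eq_iff_iff]
  omega

lemma univ_erase_eq {n : ℕ} (j : Fin (n + 1)) :
    (univ : Finset (Fin (n + 1))).erase j = univ.map (Fin.succAboveEmb j) := by
  ext i
  simp only [mem_erase, mem_univ, and_true, mem_map, true_and, Fin.coe_succAboveEmb]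
  constructor
  · intro h
    exact Fin.exists_succAbove_eq h
  · rintro ⟨i, rfl⟩
    exact Fin.succAbove_ne j i

lemma gS_succAbove {F : Type} [Field F] {n : ℕ} (z : Fin (n + 1) → F) (q : ℤ) (j : Fin (n + 1)) :
    gS univ (fun i => z (j.succAbove i)) q = gS (univ.erase j) z q := by
  unfold gS
  rw [univ_erase_eq, sum_map]
  refine sum_congr rfl fun k _ => ?_
  rw [card_map, ← map_erase, prod_map]
  rfl

/-- `hpoly` at natural indices. -/
def hN {R : Type} [CommRing R] {N : ℕ} (x : Fin N → R) (m : ℕ) : R :=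
  ∑ f ∈ Finset.univ.filter (fun f : Fin m → Fin N => Monotone f), ∏ i, x (f i)

lemma hpoly_natCast {R : Type} [CommRing R] {N : ℕ} (x : Fin N → R) (m : ℕ) :
    hpoly x (m : ℤ) = hN x m := by
  unfold hpoly
  rw [if_pos (by positivity)]
  rfl

lemma hN_zero {R : Type} [CommRing R] {N : ℕ} (x : Fin N → R) : hN x 0 = 1 := by
  unfold hN
  rw [filter_true_of_mem]
  · simp
  · intro f _ i
    exact i.elim0

lemma hN_empty {R : Type} [CommRing R] (x : Fin 0 → R) (m : ℕ) : hN x (m + 1) = 0 := by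
  unfold hN
  apply sum_eq_zero
  intro f _
  exact (f 0).elim0

lemma hN_succ {R : Type} [CommRing R] {N : ℕ} (x : Fin (N + 1) → R) (m : ℕ) :
    hN x (m + 1) = hN (fun i : Fin N => x i.succ) (m + 1) + x 0 * hN x m := by
  unfold hN
  rw [← sum_filter_add_sum_filter_not _ (fun f : Fin (m + 1) → Fin (N + 1) => f 0 ≠ 0)]
  congr 1
  · symm
    refine sum_nbij (fun g i => (g i).succ) ?_ ?_ ?_ ?_
    · intro g hg
      simp only [mem_filter, mem_univ, true_and] at hg ⊢
      exact ⟨fun a b h => Fin.succ_le_succ_iff.2 (hg h), Fin.succ_ne_zero _⟩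
    · intro g _ g' _ h
      funext i
      exact Fin.succ_injective _ (congrFun h i)
    · intro f hf
      simp only [coe_filter, mem_filter, mem_univ, true_and, Set.mem_ofPred_eq] at hf
      have hne : ∀ i, f i ≠ 0 := fun i h => hf.2 (by
        have := hf.1 (Fin.zero_le i)
        rw [h] at this
        exact Fin.le_zero_iff.1 this)
      refine ⟨fun i => (f i).pred (hne i), ?_, ?_⟩
      · simp only [coe_filter, mem_univ, true_and, Set.mem_ofPred_eq]
        intro a b h
        exact Fin.pred_le_pred_iff.2 (hf.1 h)
      · funext i
        simp
    · intro g _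
      rfl
  · rw [mul_sum]
    refine sum_nbij' (fun f i => f i.succ) (fun g => Fin.cons 0 g) ?_ ?_ ?_ ?_ ?_
    · intro f hf
      simp only [mem_filter, mem_univ, true_and] at hf ⊢
      exact fun a b h => hf.1 (Fin.succ_le_succ_iff.2 h)
    · intro g hg
      simp only [mem_filter, mem_univ, true_and] at hg ⊢
      refine ⟨?_, by simp⟩
      intro a b h
      induction a using Fin.cases with
      | zero => simp
      | succ a =>
        induction b using Fin.cases with
        | zero => exact absurd h (by simp)
        | succ b => simpa using hg (Fin.succ_le_succ_iff.1 h)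
    · intro f hf
      simp only [mem_filter, mem_univ, true_and, not_not] at hf
      funext i
      induction i using Fin.cases with
      | zero => simp [hf.2]
      | succ i => simp
    · intro g _
      funext i
      simp
    · intro f hf
      simp only [mem_filter, mem_univ, true_and, not_not] at hf
      rw [Fin.prod_univ_succ, hf.2]

lemma hN_eq_gS {F : Type} [Field F] (N : ℕ) : ∀ (m : ℕ) (x : Fin (N + 1) → F),
    (∀ i, x i ≠ 0) → (∀ i j, x i = x j → i = j) → hN x m = gS univ x m := by
  induction N with
  | zero =>
    intro m x h0 hi
    induction m with
    | zero => rw [hN_zero, gS_low _ _ _ (fun i _ j _ h => hi i j h) (by simp) (by simp) (by simp)]; simp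
    | succ m ih =>
      rw [hN_succ, hN_empty, ih]
      unfold gS
      have hu : (univ : Finset (Fin (0 + 1))) = {0} := rfl
      simp only [hu, sum_singleton, card_singleton, erase_singleton,
        prod_empty, div_one, zero_add]
      rw [← zpow_one_add₀ (h0 0)]
      congr 1
      push_cast
      ring
  | succ N ihN =>
    intro m x h0 hi
    induction m with
    | zero => rw [hN_zero, gS_low _ _ _ (fun i _ j _ h => hi i j h) (by simp) (by simp) (by simp)]; simp
    | succ m ih =>
      have h := gS_erase univ x (m + 1) h0 (fun i _ j _ h => hi i j h) 0 (mem_univ _)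
      rw [← gS_succAbove] at h
      rw [hN_succ, ih, ihN (m + 1) _ (fun i => h0 _) (fun i j h => Fin.succ_injective _ (hi _ _ h))]
      simp only [Fin.zero_succAbove] at h
      push_cast
      rw [h]
      simp

lemma hpoly_eq_gS {F : Type} [Field F] (N : ℕ) (x : Fin (N + 1) → F) (m : ℤ)
    (h0 : ∀ i, x i ≠ 0) (hi : ∀ i j, x i = x j → i = j) (hm : -(N : ℤ) ≤ m) :
    hpoly x m = gS univ x m := by
  by_cases h : 0 ≤ m
  · obtain ⟨k, rfl⟩ := Int.eq_ofNat_of_zero_le h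
    rw [hpoly_natCast, hN_eq_gS N k x h0 hi]
  · rw [gS_low _ _ _ (fun i _ j _ h => hi i j h) (by simp) (by simpa using hm) (by omega)]
    unfold hpoly
    rw [if_neg h, if_neg (by omega)]

/-- The bialternant formula, up to a factor independent of the partition. -/
lemma schur_mul_det {F : Type} [Field F] (N : ℕ) (x : Fin (N + 1) → F)
    (h0 : ∀ i, x i ≠ 0) (hi : ∀ i j, x i = x j → i = j) (lam : Fin (N + 1) → ℕ) :
    schur (fun i => (lam i : ℤ)) x =
      (Matrix.of fun i k : Fin (N + 1) => x k ^ ((lam i : ℤ) + N - (i : ℕ))).det *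
      (Matrix.of fun k j : Fin (N + 1) => x k ^ (j : ℕ) / ∏ l ∈ univ.erase k, (x k - x l)).det := by
  unfold schur
  rw [← Matrix.det_mul]
  congr 1
  ext i j
  rw [Matrix.mul_apply, Matrix.of_apply, hpoly_eq_gS N x _ h0 hi (by have := i.2; dsimp only; omega)]
  unfold gS
  refine sum_congr rfl fun k _ => ?_
  simp only [Matrix.of_apply, card_univ, Fintype.card_fin]
  rw [← mul_div_assoc, ← zpow_natCast, ← zpow_add₀ (h0 k)]
  congr 2
  push_cast
  ring

lemma schur_zero {R : Type} [CommRing R] {N r : ℕ} (x : Fin N → R) :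
    schur (fun _ : Fin r => ((0 : ℕ) : ℤ)) x = 1 := by
  unfold schur
  rw [Matrix.det_of_isUpperTriangular]
  · apply prod_eq_one
    intro i _
    have := hpoly_natCast x 0
    rw [hN_zero] at this
    simpa using this
  · intro i j hij
    simp only [id] at hij
    simp only [Matrix.of_apply]
    unfold hpoly
    rw [if_neg]
    have : (j : ℕ) < i := hij
    push_cast
    omega

lemma schur_bialt {F : Type} [Field F] (N : ℕ) (x : Fin (N + 1) → F)
    (h0 : ∀ i, x i ≠ 0) (hi : ∀ i j, x i = x j → i = j) (lam : Fin (N + 1) → ℕ) :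
    schur (fun i => (lam i : ℤ)) x =
      (Matrix.of fun i k : Fin (N + 1) => x k ^ ((lam i : ℤ) + N - (i : ℕ))).det /
      (Matrix.of fun i k : Fin (N + 1) => x k ^ ((0 : ℤ) + N - (i : ℕ))).det := by
  have h1 := schur_mul_det N x h0 hi (fun _ => 0)
  rw [schur_zero] at h1
  push_cast at h1
  have hne : (Matrix.of fun i k : Fin (N + 1) => x k ^ ((0 : ℤ) + N - (i : ℕ))).det ≠ 0 :=
    left_ne_zero_of_mul_eq_one h1.symm
  rw [schur_mul_det N x h0 hi, eq_div_iff hne, mul_assoc, mul_comm (Matrix.det _) (Matrix.det (Matrix.of fun i k : Fin (N + 1) => x k ^ ((0 : ℤ) + N - (i : ℕ)))), ← h1, mul_one]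

/-- Product over pairs `i < j`. -/
def PP {F : Type} [Field F] {n : ℕ} (f : Fin n → Fin n → F) : F :=
  ∏ i, ∏ j, if i < j then f i j else 1

lemma PP_succAbove {F : Type} [Field F] {n : ℕ} (f : Fin (n + 1) → Fin (n + 1) → F)
    (k : Fin (n + 1)) :
    PP f = (∏ i : Fin n, if k.succAbove i < k then f (k.succAbove i) k else f k (k.succAbove i)) *
      PP (fun i j => f (k.succAbove i) (k.succAbove j)) := by
  unfold PP
  rw [Fin.prod_univ_succAbove _ k, Fin.prod_univ_succAbove _ k]
  simp only [lt_self_iff_false, if_false, one_mul]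
  have : ∀ i : Fin n, (∏ j, if k.succAbove i < j then f (k.succAbove i) j else 1)
      = (if k.succAbove i < k then f (k.succAbove i) k else 1) *
        ∏ j, if i < j then f (k.succAbove i) (k.succAbove j) else 1 := by
    intro i
    rw [Fin.prod_univ_succAbove _ k]
    simp only [Fin.succAbove_lt_succAbove_iff]
  rw [prod_congr rfl fun i _ => this i, prod_mul_distrib, ← mul_assoc, ← prod_mul_distrib]
  congr 1
  refine prod_congr rfl fun i _ => ?_
  rcases lt_or_gt_of_ne (Fin.succAbove_ne k i) with h | h
  · rw [if_neg h.not_gt, if_pos h, if_pos h, one_mul]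
  · rw [if_pos h, if_neg h.not_gt, if_neg h.not_gt, mul_one]

lemma prod_succAbove_eq {F : Type} [Field F] {n : ℕ} (f : Fin (n + 1) → F) (k : Fin (n + 1)) :
    ∏ i, f (k.succAbove i) = ∏ i ∈ univ.erase k, f i := by
  rw [univ_erase_eq, prod_map]
  rfl

lemma PP_symm {F : Type} [Field F] {n : ℕ} (f : Fin (n + 1) → Fin (n + 1) → F)
    (hf : ∀ i j, f i j = f j i) (k : Fin (n + 1)) :
    PP f = (∏ i ∈ univ.erase k, f k i) * PP (fun i j => f (k.succAbove i) (k.succAbove j)) := by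
  rw [PP_succAbove f k, ← prod_succAbove_eq]
  congr 1
  refine prod_congr rfl fun i _ => ?_
  rw [hf (k.succAbove i) k, ite_self]

def DD {F : Type} [Field F] {n : ℕ} (w : Fin n → F) : F := PP (fun i j => 1 - w i * w j)

def VV {F : Type} [Field F] {n : ℕ} (w : Fin n → F) : F := PP (fun i j => w j - w i)

lemma DD_succAbove {F : Type} [Field F] {n : ℕ} (w : Fin (n + 1) → F) (k : Fin (n + 1)) :
    DD w = (∏ i ∈ univ.erase k, (1 - w k * w i)) * DD (fun i => w (k.succAbove i)) :=
  PP_symm _ (fun i j => by ring) k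

lemma VV_succAbove {F : Type} [Field F] {n : ℕ} (w : Fin (n + 1) → F) (k : Fin (n + 1)) :
    VV w = (-1) ^ (n + (k : ℕ)) * (∏ i ∈ univ.erase k, (w k - w i)) *
      VV (fun i => w (k.succAbove i)) := by
  unfold VV
  rw [PP_succAbove _ k, ← prod_succAbove_eq]
  congr 1
  have : ∀ i : Fin n, (if k.succAbove i < k then w k - w (k.succAbove i)
      else w (k.succAbove i) - w k) =
      (if k.succAbove i < k then 1 else -1) * (w k - w (k.succAbove i)) := by
    intro i
    split_ifs <;> ring
  rw [prod_congr rfl fun i _ => this i, prod_mul_distrib]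
  congr 1
  rw [prod_ite, prod_const_one, one_mul, prod_const]
  have hc : (filter (fun i : Fin n => ¬ k.succAbove i < k) univ).card = n - (k : ℕ) := by
    have h1 : (filter (fun i : Fin n => ¬ k.succAbove i < k) univ)
        = filter (fun i : Fin n => (k : ℕ) ≤ i) univ := by
      ext i
      simp only [mem_filter, mem_univ, true_and, Fin.succAbove_lt_iff_castSucc_lt, not_lt]
      rw [Fin.le_def, Fin.val_castSucc]
    rw [h1]
    rw [← Finset.card_map Fin.valEmbedding]
    have h2 : (filter (fun i : Fin n => (k : ℕ) ≤ i) univ).map Fin.valEmbedding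
        = Finset.Ico (k : ℕ) n := by
      ext t
      simp only [mem_map, mem_filter, mem_univ, true_and, Fin.valEmbedding_apply, mem_Ico]
      constructor
      · rintro ⟨i, h, rfl⟩
        exact ⟨h, i.2⟩
      · rintro ⟨h, h'⟩
        exact ⟨⟨t, h'⟩, h, rfl⟩
    rw [h2, Nat.card_Ico]
  rw [hc]
  have hk : (k : ℕ) ≤ n := Nat.lt_succ_iff.1 k.2
  have : n + (k : ℕ) = (n - (k : ℕ)) + 2 * (k : ℕ) := by omega
  rw [this, pow_add, pow_mul]
  simp

/-- Genericity of a tuple. -/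
structure Good {F : Type} [Field F] {n : ℕ} (z : Fin n → F) : Prop where
  ne0 : ∀ i, z i ≠ 0
  inj : ∀ i j, z i = z j → i = j
  mul : ∀ i j, z i * z j ≠ 1

lemma Good.removed {F : Type} [Field F] {n : ℕ} {z : Fin (n + 1) → F} (h : Good z)
    (k : Fin (n + 1)) : Good (fun i => z (k.succAbove i)) :=
  ⟨fun _ => h.ne0 _, fun _ _ e => Fin.succAbove_right_injective (h.inj _ _ e),
    fun _ _ => h.mul _ _⟩

def flp {F : Type} [Field F] {n : ℕ} (e : Fin n → Bool) (z : Fin n → F) : Fin n → F :=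
  fun j => if e j then (z j)⁻¹ else z j

def sg (F : Type) [Field F] {n : ℕ} (e : Fin n → Bool) : F := ∏ i, if e i then (-1 : F) else 1

def zI {F : Type} [Field F] {n : ℕ} (e : Fin n → Bool) (z : Fin n → F) : F :=
  ∏ i, if e i then z i else 1

def YY {F : Type} [Field F] {n : ℕ} (σ : F) (z : Fin n → F) (m q : ℤ) : F :=
  ∑ e : Fin n → Bool, (1 + σ * sg F e) * (zI e z ^ m * gS univ (flp e z) q / DD (flp e z))

lemma flp_ne0 {F : Type} [Field F] {n : ℕ} (e : Fin n → Bool) {z : Fin n → F} (hz : Good z)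
    (i : Fin n) : flp e z i ≠ 0 := by
  unfold flp
  split_ifs
  · exact inv_ne_zero (hz.ne0 i)
  · exact hz.ne0 i

lemma flp_inj {F : Type} [Field F] {n : ℕ} (e : Fin n → Bool) {z : Fin n → F} (hz : Good z)
    (i j : Fin n) (h : flp e z i = flp e z j) : i = j := by
  unfold flp at h
  have hi := hz.ne0 i
  have hj := hz.ne0 j
  split_ifs at h
  · exact hz.inj _ _ (inv_injective h)
  · exact absurd (by rw [← h]; field_simp) (hz.mul i j)
  · exact absurd (by rw [h]; field_simp) (hz.mul i j)
  · exact hz.inj _ _ h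

lemma flp_mul {F : Type} [Field F] {n : ℕ} (e : Fin n → Bool) {z : Fin n → F} (hz : Good z)
    (i j : Fin n) (hij : i ≠ j) : flp e z i * flp e z j ≠ 1 := by
  unfold flp
  have hi := hz.ne0 i
  have hj := hz.ne0 j
  intro h
  split_ifs at h
  · apply hz.mul i j
    field_simp at h
    exact h.symm
  · apply hij
    apply hz.inj
    field_simp at h
    exact h.symm
  · apply hij
    apply hz.inj
    field_simp at h
    exact h
  · exact hz.mul i j h

/-- Summand in the expansion of `YY`. -/
def trm {F : Type} [Field F] {n : ℕ} (z : Fin (n + 1) → F) (m q : ℤ) (e : Fin (n + 1) → Bool)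
    (k : Fin (n + 1)) : F :=
  zI e z ^ m * flp e z k ^ (q + n) /
    ((∏ l ∈ univ.erase k, (flp e z k - flp e z l) * (1 - flp e z k * flp e z l)) *
      DD (fun i => flp e z (k.succAbove i)))

lemma YY_eq_trm {F : Type} [Field F] {n : ℕ} (σ : F) (z : Fin (n + 1) → F) (m q : ℤ) :
    YY σ z m q = ∑ k, ∑ e : Fin (n + 1) → Bool, (1 + σ * sg F e) * trm z m q e k := by
  unfold YY
  rw [sum_comm]
  refine sum_congr rfl fun e _ => ?_
  rw [← mul_sum]
  congr 1
  unfold gS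
  rw [mul_sum, sum_div]
  refine sum_congr rfl fun k _ => ?_
  rw [DD_succAbove _ k]
  unfold trm
  have : q + ((univ : Finset (Fin (n + 1))).card : ℤ) - 1 = q + n := by simp; ring
  rw [this, prod_mul_distrib, ← mul_div_assoc, div_div, mul_assoc (∏ l ∈ univ.erase k, _)]

def tog {n : ℕ} (k : Fin n) (e : Fin n → Bool) : Fin n → Bool := Function.update e k (!e k)

lemma tog_same {n : ℕ} (k : Fin n) (e : Fin n → Bool) : tog k e k = !e k := by simp [tog]

lemma tog_ne {n : ℕ} (k : Fin n) (e : Fin n → Bool) (i : Fin n) (h : i ≠ k) : tog k e i = e i := by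
  simp [tog, h]

lemma tog_tog {n : ℕ} (k : Fin n) : Function.Involutive (tog k) := by
  intro e
  funext i
  by_cases h : i = k
  · subst h; simp [tog]
  · rw [tog_ne k _ i h, tog_ne k _ i h]

lemma sg_tog {F : Type} [Field F] {n : ℕ} (k : Fin n) (e : Fin n → Bool) :
    sg F (tog k e) = - sg F e := by
  unfold sg
  rw [← mul_prod_erase univ _ (mem_univ k), ← mul_prod_erase univ (fun i => if e i then (-1 : F) else 1) (mem_univ k), tog_same]
  rw [prod_congr rfl fun i hi => by rw [tog_ne k e i (mem_erase.1 hi).1]]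
  cases e k <;> simp

lemma flp_tog_same {F : Type} [Field F] {n : ℕ} (k : Fin n) (e : Fin n → Bool) (z : Fin n → F) :
    flp (tog k e) z k = (flp e z k)⁻¹ := by
  unfold flp
  rw [tog_same]
  cases e k <;> simp

lemma flp_tog_ne {F : Type} [Field F] {n : ℕ} (k : Fin n) (e : Fin n → Bool) (z : Fin n → F)
    (i : Fin n) (h : i ≠ k) :
    flp (tog k e) z i = flp e z i := by
  unfold flp
  rw [tog_ne k e i h]

lemma zI_tog {F : Type} [Field F] {n : ℕ} (k : Fin n) (e : Fin n → Bool) (z : Fin n → F)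
    (hz : z k ≠ 0) : zI (tog k e) z = zI e z * flp e z k := by
  unfold zI flp
  rw [← mul_prod_erase univ _ (mem_univ k), ← mul_prod_erase univ (fun i => if e i then z i else 1) (mem_univ k), tog_same]
  rw [prod_congr rfl fun i hi => by rw [tog_ne k e i (mem_erase.1 hi).1]]
  cases e k
  · simp [mul_comm]
  · simp
    field_simp

lemma trm_tog {F : Type} [Field F] {n : ℕ} {z : Fin (n + 1) → F} (hz : Good z) (m q : ℤ)
    (e : Fin (n + 1) → Bool) (k : Fin (n + 1)) :
    trm z m (m - q) (tog k e) k = trm z m q e k := by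
  unfold trm
  have hw := flp_ne0 e hz k
  set w := flp e z with hwdef
  have e1 : (fun i => flp (tog k e) z (k.succAbove i)) = fun i => w (k.succAbove i) := by
    funext i
    exact flp_tog_ne k e z _ (Fin.succAbove_ne k i)
  have e2 : ∏ l ∈ univ.erase k, (flp (tog k e) z k - flp (tog k e) z l) *
      (1 - flp (tog k e) z k * flp (tog k e) z l)
      = (w k ^ (2 * n))⁻¹ * ∏ l ∈ univ.erase k, (w k - w l) * (1 - w k * w l) := by
    have : ∀ l ∈ univ.erase k, (flp (tog k e) z k - flp (tog k e) z l) *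
        (1 - flp (tog k e) z k * flp (tog k e) z l)
        = (w k ^ 2)⁻¹ * ((w k - w l) * (1 - w k * w l)) := by
      intro l hl
      rw [flp_tog_same, flp_tog_ne k e z l (mem_erase.1 hl).1, ← hwdef]
      field_simp
    rw [prod_congr rfl this, prod_mul_distrib, prod_const, card_erase_of_mem (mem_univ k)]
    simp [pow_mul]
  rw [e1, e2, flp_tog_same, zI_tog k e z (hz.ne0 k), ← hwdef, mul_zpow]
  rw [inv_zpow', mul_assoc (w k ^ (2 * n))⁻¹, ← div_div, div_inv_eq_mul]
  congr 1
  rw [mul_assoc, mul_assoc]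
  congr 1
  rw [← zpow_natCast, ← zpow_add₀ hw, ← zpow_add₀ hw]
  congr 1
  push_cast
  ring

lemma YY_dual {F : Type} [Field F] {n : ℕ} {z : Fin (n + 1) → F} (hz : Good z) (σ : F)
    (m q : ℤ) : YY σ z m q = YY (-σ) z m (m - q) := by
  rw [YY_eq_trm, YY_eq_trm]
  refine sum_congr rfl fun k _ => ?_
  rw [← Equiv.sum_comp (tog_tog k).toPerm]
  refine sum_congr rfl fun e _ => ?_
  simp only [Function.Involutive.coe_toPerm]
  rw [sg_tog]
  have h := trm_tog hz m (m - q) e k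
  rw [sub_sub_cancel] at h
  rw [h]
  ring

lemma step_e {F : Type} [Field F] [CharZero F] {n : ℕ} {z : Fin (n + 1) → F} (hz : Good z)
    (e : Fin (n + 1) → Bool) (he : sg F e = 1) (p : ℤ) :
    (∑ j, if e j then (∏ i ∈ univ.erase j, (1 - z i / z j))⁻¹ *
      (gS univ (fun i => flp e z (j.succAbove i)) p / DD (fun i => flp e z (j.succAbove i))) else 0)
      = (1 - (zI e z)⁻¹) * (gS univ (flp e z) p / DD (flp e z)) := by
  have hw0 := flp_ne0 e hz
  have hwi := flp_inj e hz
  have hwm := flp_mul e hz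
  have hwI : ∀ i, e i → flp e z i = (z i)⁻¹ := fun i hi => by simp [flp, hi]
  have hwN : ∀ i, ¬ e i → flp e z i = z i := fun i hi => by simp [flp, hi]
  set w := flp e z with hwdef
  set I : Finset (Fin (n + 1)) := univ.filter (fun i => e i = true) with hI
  have hIe : ∀ i, i ∈ I ↔ e i = true := fun i => by simp [hI]
  have hev : Even I.card := by
    unfold sg at he
    rw [prod_ite, prod_const_one, mul_one, prod_const] at he
    have n1 : (-1 : F) ≠ 1 := by
      intro h
      have : (2 : F) = 0 := by linear_combination -h
      exact two_ne_zero this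
    exact (neg_one_pow_eq_one_iff_even n1).1 he
  obtain ⟨A, B⟩ := AB_idx I w (fun i _ => hw0 i) (fun i hi => by
      rw [hwI i ((hIe i).1 hi), ← mul_inv]
      exact fun h => hz.mul i i (inv_eq_one.1 h)) (fun i _ j _ h => hwi i j h) hev
  have hzI : ∏ a ∈ I, w a = (zI e z)⁻¹ := by
    unfold zI
    rw [prod_ite, prod_const_one, mul_one, ← prod_inv_distrib]
    exact prod_congr rfl fun i hi => hwI i ((hIe i).1 hi)
  rw [← sum_filter]
  have term : ∀ j ∈ I, (∏ i ∈ univ.erase j, (1 - z i / z j))⁻¹ *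
      (gS univ (fun i => w (j.succAbove i)) p / DD (fun i => w (j.succAbove i)))
      = (gS univ w p / DD w) * (∏ b ∈ I.erase j, (1 - w b * w j) / (1 - w j / w b))
        - (gS univ w (p - 1) / DD w) *
          (w j * ∏ b ∈ I.erase j, (1 - w b * w j) / (1 - w j / w b)) := by
    intro j hj
    have hne : ∏ i ∈ univ.erase j, (1 - w j * w i) ≠ 0 := prod_ne_zero_iff.2 fun i hi h =>
      hwm j i (mem_erase.1 hi).1.symm (sub_eq_zero.1 h).symm
    have hprod : ∏ b ∈ I.erase j, (1 - w b * w j) / (1 - w j / w b)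
        = (∏ i ∈ univ.erase j, (1 - w j * w i)) * (∏ i ∈ univ.erase j, (1 - z i / z j))⁻¹ := by
      rw [← prod_inv_distrib, ← prod_mul_distrib]
      have hsub : I.erase j ⊆ univ.erase j := erase_subset_erase _ (subset_univ _)
      rw [← prod_subset hsub]
      · refine prod_congr rfl fun b hb => ?_
        rw [hwI b ((hIe b).1 (mem_erase.1 hb).2), hwI j ((hIe j).1 hj), div_eq_mul_inv, mul_comm (z b)⁻¹]
        congr 3
        have := hz.ne0 b
        have := hz.ne0 j
        field_simp
      · intro b hb hb'
        have hbI : ¬ e b := fun h => hb' (mem_erase.2 ⟨(mem_erase.1 hb).1, (hIe b).2 h⟩)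
        have h1 : 1 - w j * w b ≠ 0 := fun h =>
          hwm j b (mem_erase.1 hb).1.symm (sub_eq_zero.1 h).symm
        have h2 : z b / z j = w j * w b := by
          rw [hwN b hbI, hwI j ((hIe j).1 hj)]
          field_simp
        rw [h2, mul_inv_cancel₀ h1]
    rw [gS_succAbove, gS_erase univ w p hw0 (fun i _ j _ h => hwi i j h) j (mem_univ j), hprod,
      DD_succAbove w j]
    field_simp
  rw [sum_congr rfl term, sum_sub_distrib, ← mul_sum, ← mul_sum, A, B, hzI]
  ring

/-- Number of odd columns, complemented version. -/
def oc {n : ℕ} (C : ℕ) (κ : Fin n → ℕ) : ℕ :=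
  ((Finset.Icc 1 C).filter (fun t => Odd (univ.filter (fun i => t ≤ κ i)).card)).card

lemma oc_le {n : ℕ} (C : ℕ) (κ : Fin n → ℕ) : oc C κ ≤ C := by
  unfold oc
  refine (card_filter_le _ _).trans ?_
  simp

def snc {n : ℕ} (κ : Fin n → ℕ) (m : ℕ) : Fin (n + 1) → ℕ := Fin.snoc (α := fun _ => ℕ) κ m

lemma snc_last {n : ℕ} (κ : Fin n → ℕ) (m : ℕ) : snc κ m (Fin.last n) = m := by simp [snc]

lemma snc_castSucc {n : ℕ} (κ : Fin n → ℕ) (m : ℕ) (i : Fin n) : snc κ m i.castSucc = κ i := by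
  simp [snc]

lemma oc_snc {n : ℕ} (C m : ℕ) (κ : Fin n → ℕ) (hκ : ∀ i, κ i ≤ m) (hm : m ≤ C) :
    oc C (snc κ m) + oc m κ = m := by
  have hcount : ∀ t, (univ.filter (fun i => t ≤ snc κ m i)).card
      = (univ.filter (fun i => t ≤ κ i)).card + if t ≤ m then 1 else 0 := by
    intro t
    rw [card_filter, Fin.sum_univ_castSucc, card_filter]
    simp only [snc_last, snc_castSucc]
  have h1 : (Finset.Icc 1 C).filter (fun t => Odd (univ.filter (fun i => t ≤ snc κ m i)).card)
      = (Finset.Icc 1 m).filter (fun t => ¬ Odd (univ.filter (fun i => t ≤ κ i)).card) := by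
    ext t
    simp only [mem_filter, mem_Icc, hcount]
    by_cases ht : t ≤ m
    · simp only [ht, if_true, Nat.odd_add_one]
      constructor
      · rintro ⟨⟨a, _⟩, c⟩; exact ⟨⟨a, trivial⟩, c⟩
      · rintro ⟨⟨a, _⟩, c⟩; exact ⟨⟨a, by omega⟩, c⟩
    · have : (univ.filter (fun i => t ≤ κ i)) = ∅ := by
        apply filter_false_of_mem
        intro i _
        have := hκ i
        omega
      simp [ht, this]
  unfold oc
  rw [h1, add_comm, card_filter_add_card_filter_not]
  simp

def idx (n C p : ℕ) : Finset (Fin n → ℕ) :=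
  (Fintype.piFinset fun _ : Fin n => Finset.range (C + 1)).filter
    (fun κ => Monotone κ ∧ oc C κ = p)

lemma mem_idx {n C p : ℕ} (κ : Fin n → ℕ) :
    κ ∈ idx n C p ↔ (∀ i, κ i ≤ C) ∧ Monotone κ ∧ oc C κ = p := by
  simp [idx, Nat.lt_succ_iff]

lemma sum_idx {M : Type} [AddCommMonoid M] (n C p : ℕ) (G : (Fin (n + 1) → ℕ) → M) :
    ∑ κ ∈ idx (n + 1) C p, G κ = ∑ m ∈ Finset.Icc p C, ∑ κ ∈ idx n m (m - p), G (snc κ m) := by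
  rw [sum_sigma']
  refine sum_bij' (fun κ _ => (⟨κ (Fin.last n), fun i => κ i.castSucc⟩ : (_ : ℕ) × (Fin n → ℕ)))
    (fun s _ => snc s.2 s.1) ?_ ?_ ?_ ?_ ?_
  · intro κ hκ
    obtain ⟨h1, h2, h3⟩ := (mem_idx κ).1 hκ
    have hs : κ = snc (fun i => κ i.castSucc) (κ (Fin.last n)) := by
      funext i
      induction i using Fin.lastCases with
      | last => rw [snc_last]
      | cast i => rw [snc_castSucc]
    have ho := oc_snc C (κ (Fin.last n)) (fun i => κ i.castSucc) (fun i => h2 (Fin.le_last _)) (h1 _)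
    rw [← hs, h3] at ho
    simp only [mem_sigma, mem_Icc, mem_idx]
    refine ⟨⟨by omega, h1 _⟩, fun i => h2 (Fin.le_last _), fun i j h => h2 (by simpa using h), by omega⟩
  · rintro ⟨m, κ⟩ hs
    simp only [mem_sigma, mem_Icc, mem_idx] at hs ⊢
    obtain ⟨⟨h1, h2⟩, h3, h4, h5⟩ := hs
    have ho := oc_snc C m κ h3 h2
    refine ⟨?_, ?_, by omega⟩
    · intro i
      induction i using Fin.lastCases with
      | last => rw [snc_last]; exact h2
      | cast i => rw [snc_castSucc]; exact (h3 i).trans h2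
    · intro i j hij
      induction j using Fin.lastCases with
      | last =>
        rw [snc_last]
        induction i using Fin.lastCases with
        | last => rw [snc_last]
        | cast i => rw [snc_castSucc]; exact h3 i
      | cast j =>
        induction i using Fin.lastCases with
        | last => exact absurd hij (by simp [Fin.castSucc_lt_last])
        | cast i =>
          rw [snc_castSucc, snc_castSucc]
          exact h4 (by simpa using hij)
  · intro κ _
    funext i
    induction i using Fin.lastCases with
    | last => rw [snc_last]
    | cast i => rw [snc_castSucc]
  · rintro ⟨m, κ⟩ _
    simp only [snc_last, snc_castSucc]
  · intro κ _
    congr 1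
    funext i
    induction i using Fin.lastCases with
    | last => rw [snc_last]
    | cast i => rw [snc_castSucc]

def alt {F : Type} [Field F] {n : ℕ} (κ : Fin n → ℕ) (z : Fin n → F) : F :=
  (Matrix.of fun i j : Fin n => z j ^ (κ i + i)).det

def AA {F : Type} [Field F] {n : ℕ} (C p : ℕ) (z : Fin n → F) : F := ∑ κ ∈ idx n C p, alt κ z

lemma alt_snc {F : Type} [Field F] {n : ℕ} (κ : Fin n → ℕ) (m : ℕ) (z : Fin (n + 1) → F) :
    alt (snc κ m) z = ∑ j : Fin (n + 1), (-1) ^ (n + (j : ℕ)) * z j ^ (m + n) *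
      alt κ (fun i => z (j.succAbove i)) := by
  unfold alt
  rw [Matrix.det_succ_row _ (Fin.last n)]
  refine sum_congr rfl fun j _ => ?_
  simp only [Matrix.of_apply, snc_last, Fin.val_last, Fin.succAbove_last]
  congr 2
  ext a b
  simp [snc_castSucc]

lemma AA_rec {F : Type} [Field F] {n : ℕ} (C p : ℕ) (z : Fin (n + 1) → F) :
    AA C p z = ∑ m ∈ Finset.Icc p C, ∑ j : Fin (n + 1), (-1) ^ (n + (j : ℕ)) * z j ^ (m + n) *
      AA m (m - p) (fun i => z (j.succAbove i)) := by
  unfold AA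
  rw [sum_idx]
  refine sum_congr rfl fun m _ => ?_
  rw [sum_congr rfl fun κ _ => alt_snc κ m z, sum_comm]
  refine sum_congr rfl fun j _ => ?_
  rw [mul_sum]

lemma sg_ins {F : Type} [Field F] {n : ℕ} (j : Fin (n + 1)) (e : Fin n → Bool) :
    sg F (Fin.insertNth (α := fun _ => Bool) j true e) = - sg F e := by
  unfold sg
  rw [Fin.prod_univ_succAbove _ j]
  simp

lemma zI_ins {F : Type} [Field F] {n : ℕ} (j : Fin (n + 1)) (e : Fin n → Bool)
    (z : Fin (n + 1) → F) :
    zI (Fin.insertNth (α := fun _ => Bool) j true e) z = z j * zI e (fun i => z (j.succAbove i)) := by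
  unfold zI
  rw [Fin.prod_univ_succAbove _ j]
  simp

lemma flp_ins {F : Type} [Field F] {n : ℕ} (j : Fin (n + 1)) (e : Fin n → Bool)
    (z : Fin (n + 1) → F) :
    (fun i => flp (Fin.insertNth (α := fun _ => Bool) j true e) z (j.succAbove i))
      = flp e (fun i => z (j.succAbove i)) := by
  funext i
  unfold flp
  simp

lemma sum_ins {M : Type} [AddCommMonoid M] {n : ℕ} (j : Fin (n + 1))
    (G : (Fin (n + 1) → Bool) → M) :
    ∑ e : Fin n → Bool, G (Fin.insertNth (α := fun _ => Bool) j true e)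
      = ∑ e : Fin (n + 1) → Bool, if e j then G e else 0 := by
  rw [← Equiv.sum_comp (Fin.insertNthEquiv (fun _ => Bool) j), Fintype.sum_prod_type,
    Fintype.sum_bool]
  simp [Fin.insertNthEquiv]

lemma main_step {F : Type} [Field F] [CharZero F] {n : ℕ} {z : Fin (n + 2) → F} (hz : Good z)
    (m : ℕ) (p : ℤ) :
    ∑ j : Fin (n + 2), (-1) ^ (n + 1 + (j : ℕ)) * z j ^ (m + (n + 1)) *
      (VV (fun i => z (j.succAbove i)) * YY 1 (fun i => z (j.succAbove i)) m (m - p))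
      = VV z * (YY 1 z m p - YY 1 z (m - 1) p) := by
  have h1 : ∀ j : Fin (n + 2), (-1) ^ (n + 1 + (j : ℕ)) * z j ^ (m + (n + 1)) *
      (VV (fun i => z (j.succAbove i)) * YY 1 (fun i => z (j.succAbove i)) m (m - p))
      = VV z * ∑ e : Fin (n + 2) → Bool, (1 + sg F e) * zI e z ^ m *
        (if e j then (∏ i ∈ univ.erase j, (1 - z i / z j))⁻¹ *
      (gS univ (fun i => flp e z (j.succAbove i)) p / DD (fun i => flp e z (j.succAbove i))) else 0) := by
    intro j
    have hj := hz.ne0 j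
    have hprod : ∏ i ∈ univ.erase j, (z j - z i)
        = z j ^ (n + 1) * ∏ i ∈ univ.erase j, (1 - z i / z j) := by
      have : z j ^ (n + 1) = ∏ i ∈ univ.erase j, z j := by simp
      rw [this, ← prod_mul_distrib]
      refine prod_congr rfl fun i _ => ?_
      field_simp
    have hne : ∏ i ∈ univ.erase j, (1 - z i / z j) ≠ 0 := by
      refine prod_ne_zero_iff.2 fun i hi h => (mem_erase.1 hi).1 (hz.inj _ _ ?_)
      have := sub_eq_zero.1 h
      field_simp at this
      exact this.symm
    have hsgn : ((-1 : F) ^ (n + 1 + (j : ℕ))) * (-1) ^ (n + 1 + (j : ℕ)) = 1 := by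
      rw [← mul_pow]; simp
    rw [YY_dual (hz.removed j) 1 m (m - p), VV_succAbove z j, hprod, sub_sub_cancel]
    unfold YY
    have h2 : ∀ e : Fin (n + 2) → Bool, (1 + sg F e) * zI e z ^ m *
        (if e j then (∏ i ∈ univ.erase j, (1 - z i / z j))⁻¹ *
      (gS univ (fun i => flp e z (j.succAbove i)) p / DD (fun i => flp e z (j.succAbove i))) else 0)
      = if e j then (1 + sg F e) * zI e z ^ m * ((∏ i ∈ univ.erase j, (1 - z i / z j))⁻¹ *
      (gS univ (fun i => flp e z (j.succAbove i)) p / DD (fun i => flp e z (j.succAbove i)))) else 0 := by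
      intro e
      rw [mul_ite, mul_zero]
    rw [sum_congr rfl fun e _ => h2 e, ← sum_ins j (fun e => (1 + sg F e) * zI e z ^ m * ((∏ i ∈ univ.erase j, (1 - z i / z j))⁻¹ *
      (gS univ (fun i => flp e z (j.succAbove i)) p / DD (fun i => flp e z (j.succAbove i)))))]
    rw [mul_sum, mul_sum, mul_sum]
    refine sum_congr rfl fun e _ => ?_
    rw [sg_ins, zI_ins, flp_ins, zpow_natCast, mul_pow]
    clear h2 hprod
    generalize ∏ i ∈ univ.erase j, (1 - z i / z j) = Q at hne ⊢
    field_simp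
    ring
  rw [sum_congr rfl fun j _ => h1 j, ← mul_sum, sum_comm]
  congr 1
  unfold YY
  rw [← sum_sub_distrib]
  refine sum_congr rfl fun e _ => ?_
  rw [← mul_sum]
  have hz0 : zI e z ≠ 0 := by
    unfold zI
    refine prod_ne_zero_iff.2 fun i _ => ?_
    split_ifs
    · exact hz.ne0 i
    · exact one_ne_zero
  have hs : sg F e = 1 ∨ sg F e = -1 := by
    unfold sg
    refine prod_induction _ (fun t : F => t = 1 ∨ t = -1) ?_ (Or.inl rfl) ?_
    · rintro a b (rfl | rfl) (rfl | rfl) <;> simp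
    · intro i _
      split_ifs <;> simp
  rcases hs with hs | hs
  · rw [step_e hz e hs, zpow_sub_one₀ hz0, zpow_natCast]
    ring
  · rw [hs]; ring

lemma main_thm {F : Type} [Field F] [CharZero F] (n : ℕ) : ∀ (z : Fin (n + 1) → F), Good z →
    ∀ C p : ℕ, p ≤ C → 2 * AA C p z = VV z * YY 1 z C p := by
  induction n with
  | zero =>
    intro z hz C p hp
    rw [AA_rec]
    have hA : ∀ (m : ℕ) (w : Fin 0 → F), AA m (m - p) w = if m - p = 0 then 1 else 0 := by
      intro m w
      have ho : ∀ κ : Fin 0 → ℕ, oc m κ = 0 := by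
        intro κ
        simp [oc]
      unfold AA idx
      by_cases h : m - p = 0
      · rw [if_pos h, filter_true_of_mem]
        · simp [alt]
        · intro κ _
          exact ⟨fun i => i.elim0, by rw [ho, h]⟩
      · rw [if_neg h, filter_false_of_mem]
        · simp
        · rintro κ _ ⟨_, h'⟩
          exact h (by rw [← h', ho])
    have hs : ∀ m ∈ Finset.Icc p C, (∑ j : Fin (0 + 1), (-1) ^ (0 + (j : ℕ)) * z j ^ (m + 0) *
      AA m (m - p) (fun i => z (j.succAbove i))) = if m = p then z 0 ^ p else 0 := by
      intro m hm
      have := (mem_Icc.1 hm).1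
      rw [Fin.sum_univ_one, hA]
      by_cases h : m = p
      · subst h; simp
      · rw [if_neg (by omega), if_neg h, mul_zero]
    rw [sum_congr rfl hs, sum_ite_eq' , if_pos (by simp [hp])]
    have hV : VV z = 1 := by simp [VV, PP]
    have hD : ∀ w : Fin (0 + 1) → F, DD w = 1 := by intro w; simp [DD, PP]
    unfold YY
    rw [hV, ← Equiv.sum_comp (Equiv.funUnique (Fin 1) Bool).symm, Fintype.sum_bool]
    simp only [hD]
    simp [sg, zI, gS, flp]
    exact Or.inl (by ring)
  | succ n ih =>
    intro z hz C p hp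
    rw [AA_rec, mul_sum]
    have hs : ∀ m ∈ Finset.Icc p C, 2 * (∑ j : Fin (n + 1 + 1), (-1) ^ (n + 1 + (j : ℕ)) *
        z j ^ (m + (n + 1)) * AA m (m - p) (fun i => z (j.succAbove i)))
        = VV z * (YY 1 z m p - YY 1 z (m - 1) p) := by
      intro m hm
      have := (mem_Icc.1 hm).1
      rw [← main_step hz m p, mul_sum]
      refine sum_congr rfl fun j _ => ?_
      have := ih _ (hz.removed j) m (m - p) (by omega)
      rw [Nat.cast_sub (by omega)] at this
      rw [← this]
      ring
    rw [sum_congr rfl hs, ← mul_sum]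
    congr 1
    have hlow : YY 1 z ((p : ℤ) - 1) p = 0 := by
      rw [YY_dual hz]
      unfold YY
      refine sum_eq_zero fun e _ => ?_
      rw [gS_low _ _ _ (fun i _ j _ h => flp_inj e hz i j h) (by simp) (by simp) (by omega),
        if_neg (by omega)]
      simp
    obtain ⟨d, rfl⟩ := Nat.exists_eq_add_of_le hp
    clear hs hp
    induction d with
    | zero => simp [hlow]
    | succ d ihd =>
      rw [← add_assoc, Finset.sum_Icc_succ_top (by omega), ihd]
      push_cast
      rw [add_sub_cancel_right]
      ring

lemma alt_zero {F : Type} [Field F] {n : ℕ} (z : Fin n → F) : alt (fun _ => 0) z = VV z := by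
  unfold alt VV PP
  have : (Matrix.of fun i j : Fin n => z j ^ ((fun _ => 0 : Fin n → ℕ) i + (i : ℕ)))
      = (Matrix.vandermonde z).transpose := by
    ext i j
    simp [Matrix.vandermonde]
  rw [this, Matrix.det_transpose, Matrix.det_vandermonde]
  refine prod_congr rfl fun i _ => ?_
  rw [← prod_filter]
  refine prod_congr ?_ fun _ _ => rfl
  ext j
  simp

lemma PP_ne_zero {F : Type} [Field F] {n : ℕ} (f : Fin n → Fin n → F)
    (h : ∀ i j, i < j → f i j ≠ 0) : PP f ≠ 0 := by
  unfold PP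
  refine prod_ne_zero_iff.2 fun i _ => prod_ne_zero_iff.2 fun j _ => ?_
  split_ifs with hij
  · exact h i j hij
  · exact one_ne_zero

lemma VV_ne_zero {F : Type} [Field F] {n : ℕ} (z : Fin n → F)
    (hi : ∀ i j, z i = z j → i = j) : VV z ≠ 0 :=
  PP_ne_zero _ fun i j hij h => hij.ne (hi i j (sub_eq_zero.1 h).symm)

lemma AA_zero {F : Type} [Field F] {n : ℕ} (z : Fin n → F) : AA 0 0 z = VV z := by
  unfold AA
  have : idx n 0 0 = {fun _ => 0} := by
    ext κ
    rw [mem_idx, mem_singleton]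
    constructor
    · rintro ⟨h, -, -⟩
      funext i
      exact Nat.le_zero.1 (h i)
    · rintro rfl
      exact ⟨fun _ => le_rfl, fun _ _ _ => le_rfl, by simp [oc]⟩
  rw [this, sum_singleton, alt_zero]

lemma YY_zero {F : Type} [Field F] [CharZero F] (n : ℕ) (z : Fin (n + 1) → F) (hz : Good z) :
    YY 1 z 0 0 = 2 := by
  have h := main_thm n z hz 0 0 le_rfl
  rw [AA_zero, mul_comm] at h
  exact_mod_cast (mul_left_cancel₀ (VV_ne_zero z hz.inj) h).symm

lemma det_last {F : Type} [Field F] {N : ℕ} (w : Fin (N + 1) → F)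
    (hi : ∀ i j, w i = w j → i = j) (q : ℤ) :
    (Matrix.of fun i j : Fin (N + 1) => if (i : ℕ) < N then w j ^ (i : ℕ) else w j ^ ((N : ℤ) + q)).det
      = VV w * gS univ w q := by
  rw [Matrix.det_succ_row _ (Fin.last N)]
  unfold gS
  rw [mul_sum]
  refine sum_congr rfl fun j _ => ?_
  have hne : ∏ l ∈ univ.erase j, (w j - w l) ≠ 0 :=
    prod_ne_zero_iff.2 fun l hl h => (mem_erase.1 hl).1 (hi _ _ (sub_eq_zero.1 h).symm)
  have hm : ((Matrix.of fun i j : Fin (N + 1) => if (i : ℕ) < N then w j ^ (i : ℕ)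
      else w j ^ ((N : ℤ) + q)).submatrix (Fin.last N).succAbove j.succAbove).det
      = VV (fun i => w (j.succAbove i)) := by
    rw [← alt_zero]
    unfold alt
    congr 1
    ext a b
    simp
  rw [hm, VV_succAbove w j]
  have hc : q + ((univ : Finset (Fin (N + 1))).card : ℤ) - 1 = N + q := by simp; ring
  rw [hc]
  simp only [Matrix.of_apply, Fin.val_last, lt_irrefl, if_false]
  field_simp

lemma PP_mul {F : Type} [Field F] {n : ℕ} (f g : Fin n → Fin n → F) :
    PP f * PP g = PP (fun i j => f i j * g i j) := by
  unfold PP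
  rw [← prod_mul_distrib]
  refine prod_congr rfl fun i _ => ?_
  rw [← prod_mul_distrib]
  refine prod_congr rfl fun j _ => ?_
  split_ifs <;> simp

lemma PP_pair {F : Type} [Field F] (N : ℕ) : ∀ w : Fin (N + 1) → F,
    PP (fun i j => w i * w j) = (∏ i, w i) ^ N := by
  induction N with
  | zero => intro w; simp [PP]
  | succ N ih =>
    intro w
    rw [PP_symm _ (fun i j => mul_comm _ _) 0, ih (fun i => w ((0 : Fin (N + 2)).succAbove i)),
      prod_mul_distrib, prod_succAbove_eq, ← mul_prod_erase univ w (mem_univ 0)]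
    simp
    ring

/-- The type D Weyl denominator, up to normalization. -/
def KK {F : Type} [Field F] {n : ℕ} (z : Fin n → F) : F :=
  PP (fun i j => (z i + (z i)⁻¹) - (z j + (z j)⁻¹))

lemma KK_flp {F : Type} [Field F] {n : ℕ} (e : Fin n → Bool) (z : Fin n → F) :
    KK (flp e z) = KK z := by
  have : ∀ i, flp e z i + (flp e z i)⁻¹ = z i + (z i)⁻¹ := by
    intro i
    unfold flp
    split_ifs
    · rw [inv_inv, add_comm]
    · rfl
  unfold KK
  simp only [this]

lemma KK_eq {F : Type} [Field F] {N : ℕ} (w : Fin (N + 1) → F) (h0 : ∀ i, w i ≠ 0) :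
    VV w * DD w = KK w * (∏ i, w i) ^ N := by
  rw [← PP_pair]
  unfold VV DD KK
  rw [PP_mul, PP_mul]
  congr 1
  funext i j
  have := h0 i
  have := h0 j
  field_simp
  ring

lemma det_expand {F : Type} [Field F] {n : ℕ} (s : F) (A B : Fin n → Fin n → F) :
    (Matrix.of fun i j : Fin n => A i j + s * B i j).det
      = ∑ e : Fin n → Bool, (∏ i, if e i then s else 1) *
        (Matrix.of fun i j : Fin n => if e j then B i j else A i j).det := by
  simp only [Matrix.det_apply, mul_sum]
  rw [sum_comm]
  refine sum_congr rfl fun σ _ => ?_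
  have h : ∀ i, A (σ i) i + s * B (σ i) i
      = ∑ b : Bool, if b then s * B (σ i) i else A (σ i) i := by
    intro i
    simp [add_comm]
  simp only [Matrix.of_apply, h]
  rw [prod_univ_sum, Fintype.piFinset_univ, smul_sum]
  refine sum_congr rfl fun e _ => ?_
  rw [mul_smul_comm, ← prod_mul_distrib]
  congr 1
  refine prod_congr rfl fun i _ => ?_
  split_ifs <;> simp

lemma det_e {F : Type} [Field F] {N : ℕ} (y : Fin (N + 1) → F) (h0 : ∀ i, y i ≠ 0)
    (hz : Good (fun j => (y j ^ 2)⁻¹)) (C p : ℤ) (e : Fin (N + 1) → Bool)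
    (l : Fin (N + 1) → ℤ) (hl : ∀ i, l i = if (i : ℕ) < N then C + 2 * N - 2 * (i : ℕ) else C - 2 * p) :
    (Matrix.of fun i j : Fin (N + 1) => if e j then y j ^ (-l i) else y j ^ l i).det
      = (∏ j, y j) ^ C * KK (fun j => (y j ^ 2)⁻¹) *
        (zI e (fun j => (y j ^ 2)⁻¹) ^ C * gS univ (flp e (fun j => (y j ^ 2)⁻¹)) p /
          DD (flp e (fun j => (y j ^ 2)⁻¹))) := by
  set z : Fin (N + 1) → F := fun j => (y j ^ 2)⁻¹ with hzdef
  have hu0 : ∀ j, flp e y j ≠ 0 := fun j => by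
    unfold flp
    split_ifs
    · exact inv_ne_zero (h0 j)
    · exact h0 j
  have hwu : ∀ j, flp e z j = (flp e y j ^ 2)⁻¹ := fun j => by
    unfold flp
    split_ifs <;> simp [hzdef]
  have hw0 := flp_ne0 e hz
  have hM : (Matrix.of fun i j : Fin (N + 1) => if e j then y j ^ (-l i) else y j ^ l i)
      = Matrix.of fun i j : Fin (N + 1) => (flp e y j ^ (C + 2 * N)) *
        (Matrix.of fun i j : Fin (N + 1) => if (i : ℕ) < N then flp e z j ^ (i : ℕ)
          else flp e z j ^ ((N : ℤ) + p)) i j := by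
    ext i j
    simp only [Matrix.of_apply]
    have h1 : (if e j then y j ^ (-l i) else y j ^ l i) = flp e y j ^ l i := by
      unfold flp
      split_ifs
      · rw [inv_zpow']
      · rfl
    rw [h1, hl, hwu]
    have h2 : ∀ k : ℤ, ((flp e y j ^ 2)⁻¹) ^ k = flp e y j ^ (-2 * k) := by
      intro k
      rw [inv_zpow', ← zpow_natCast, ← zpow_mul]
      congr 1
      push_cast
      ring
    split_ifs
    · rw [← zpow_natCast _ (i : ℕ), h2, ← zpow_add₀ (hu0 j)]
      congr 1
    · rw [h2, ← zpow_add₀ (hu0 j)]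
      congr 1
      ring
  rw [hM, Matrix.det_mul_row, det_last _ (flp_inj e hz)]
  have hD : DD (flp e z) ≠ 0 := PP_ne_zero _ fun i j hij h =>
    flp_mul e hz i j hij.ne (sub_eq_zero.1 h).symm
  have hK := KK_eq (flp e z) hw0
  rw [KK_flp] at hK
  have hP : ∏ j, flp e y j ^ (C + 2 * N) = (∏ j, y j) ^ C * zI e z ^ C * ((∏ j, flp e z j) ^ N)⁻¹ := by
    have a1 : ∏ j, flp e y j = (∏ j, y j) * zI e z := by
      unfold zI flp
      rw [← prod_mul_distrib]
      refine prod_congr rfl fun j _ => ?_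
      have := h0 j
      split_ifs
      · simp only [hzdef]; field_simp
      · simp
    have a2 : ∏ j, flp e z j = ((∏ j, flp e y j) ^ 2)⁻¹ := by
      rw [← prod_pow, ← prod_inv_distrib]
      exact prod_congr rfl fun j _ => hwu j
    have hp0 : ∏ j, flp e y j ≠ 0 := prod_ne_zero_iff.2 fun j _ => hu0 j
    rw [prod_zpow, zpow_add₀ hp0, a2, inv_pow, inv_inv, ← pow_mul, ← mul_zpow, ← a1]
    congr 1
    exact_mod_cast zpow_natCast (∏ j, flp e y j) (2 * N)
  have hW : (∏ j, flp e z j) ^ N ≠ 0 := pow_ne_zero _ (prod_ne_zero_iff.2 fun j _ => hw0 j)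
  rw [hP]
  field_simp
  linear_combination ((∏ j, y j) ^ C * zI e z ^ C * gS univ (flp e z) p) * hK

lemma num_eq {F : Type} [Field F] {N : ℕ} (y : Fin (N + 1) → F) (h0 : ∀ i, y i ≠ 0)
    (hz : Good (fun j => (y j ^ 2)⁻¹)) (C p : ℤ)
    (l : Fin (N + 1) → ℤ) (hl : ∀ i, l i = if (i : ℕ) < N then C + 2 * N - 2 * (i : ℕ) else C - 2 * p) :
    (Matrix.of fun i j : Fin (N + 1) => y j ^ l i + y j ^ (-l i)).det +
    (Matrix.of fun i j : Fin (N + 1) => y j ^ l i - y j ^ (-l i)).det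
      = (∏ j, y j) ^ C * KK (fun j => (y j ^ 2)⁻¹) * YY 1 (fun j => (y j ^ 2)⁻¹) C p := by
  have h1 := det_expand 1 (fun i j => y j ^ l i) (fun i j => y j ^ (-l i))
  have h2 := det_expand (-1) (fun i j => y j ^ l i) (fun i j => y j ^ (-l i))
  simp only [one_mul, neg_mul, ite_self, prod_const_one, ← sub_eq_add_neg] at h1 h2
  rw [h1, h2, ← sum_add_distrib]
  unfold YY
  rw [mul_sum]
  refine sum_congr rfl fun e _ => ?_
  rw [det_e y h0 hz C p e l hl]
  unfold sg
  ring

lemma KK_ne_zero {F : Type} [Field F] {n : ℕ} {z : Fin n → F} (hz : Good z) : KK z ≠ 0 := by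
  refine PP_ne_zero _ fun i j hij h => ?_
  have hi := hz.ne0 i
  have hj := hz.ne0 j
  have : (z i - z j) * (z i * z j - 1) = 0 := by
    field_simp at h
    linear_combination h
  rcases mul_eq_zero.1 this with h' | h'
  · exact hij.ne (hz.inj _ _ (sub_eq_zero.1 h'))
  · exact hz.mul i j (sub_eq_zero.1 h')

lemma soEven_eq {F : Type} [Field F] [CharZero F] {N : ℕ} (y : Fin (N + 1) → F)
    (h0 : ∀ i, y i ≠ 0) (hz : Good (fun j => (y j ^ 2)⁻¹)) (C p : ℕ) (hp : p ≤ C) :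
    soEven (N + 1) (fun i => if (i : ℕ) < N + 1 - 1 then (C : ℤ) else (C : ℤ) - 2 * p) y
      = (∏ j, y j) ^ (C : ℤ) * AA C p (fun j => (y j ^ 2)⁻¹) / VV (fun j => (y j ^ 2)⁻¹) := by
  unfold soEven
  rw [num_eq y h0 hz C p (fun i => (if (i : ℕ) < N + 1 - 1 then (C : ℤ) else (C : ℤ) - 2 * p) +
    2 * ((N + 1 : ℕ) : ℤ) - 2 * ((i : ℕ) : ℤ) - 2)]
  · have hd := num_eq y h0 hz 0 0 (fun i => 2 * ((N + 1 : ℕ) : ℤ) - 2 * ((i : ℕ) : ℤ) - 2) (by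
      intro i
      have := i.2
      split_ifs
      · push_cast; ring
      · push_cast; omega)
    rw [YY_zero N _ hz] at hd
    have h2 : (Matrix.of fun i j : Fin (N + 1) => y j ^ (2 * ((N + 1 : ℕ) : ℤ) - 2 * ((i : ℕ) : ℤ) - 2)
        - y j ^ (-(2 * ((N + 1 : ℕ) : ℤ) - 2 * ((i : ℕ) : ℤ) - 2))).det = 0 := by
      apply Matrix.det_eq_zero_of_row_eq_zero (Fin.last N)
      intro j
      have : 2 * ((N + 1 : ℕ) : ℤ) - 2 * (N : ℤ) - 2 = 0 := by push_cast; ring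
      simp only [Matrix.of_apply, Fin.val_last, this]
      simp
    rw [h2, add_zero, zpow_zero, one_mul] at hd
    rw [hd]
    have hm := main_thm N _ hz C p hp
    have hK := KK_ne_zero hz
    have hV := VV_ne_zero _ hz.inj
    rw [div_eq_div_iff (mul_ne_zero hK two_ne_zero) hV]
    linear_combination (-(∏ j, y j) ^ (C : ℤ) * KK (fun j => (y j ^ 2)⁻¹)) * hm
  · intro i
    have := i.2
    have : N + 1 - 1 = N := rfl
    rw [this]
    split_ifs
    · push_cast; ring
    · push_cast; omega

lemma schur_side {F : Type} [Field F] {N : ℕ} (y : Fin (N + 1) → F)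
    (h0 : ∀ i, y i ≠ 0) (hz : Good (fun j => (y j ^ 2)⁻¹)) (C : ℕ) (ν κ : Fin (N + 1) → ℕ)
    (h : ∀ i, κ i + ν i = C) :
    schur (fun i => (ν i : ℤ)) (fun j => y j ^ 2)
      = (∏ j, y j ^ 2) ^ (C : ℤ) * alt κ (fun j => (y j ^ 2)⁻¹) / VV (fun j => (y j ^ 2)⁻¹) := by
  have hx0 : ∀ i, y i ^ 2 ≠ 0 := fun i => pow_ne_zero _ (h0 i)
  rw [schur_bialt N (fun j => y j ^ 2) hx0 (fun i j e => hz.inj i j (congrArg Inv.inv e))]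
  have key : ∀ (D : ℤ) (μ : Fin (N + 1) → ℤ) (κ : Fin (N + 1) → ℕ), (∀ i, (κ i : ℤ) + μ i = D) →
      (Matrix.of fun i k : Fin (N + 1) => (y k ^ 2) ^ (μ i + N - (i : ℕ))).det
        = (∏ j, y j ^ 2) ^ (D + N) * alt κ (fun j => (y j ^ 2)⁻¹) := by
    intro D μ κ hκ
    have : (Matrix.of fun i k : Fin (N + 1) => (y k ^ 2) ^ (μ i + N - (i : ℕ)))
        = Matrix.of fun i k : Fin (N + 1) => (y k ^ 2) ^ (D + N) *
          (Matrix.of fun i j : Fin (N + 1) => ((y j ^ 2)⁻¹) ^ (κ i + i)) i k := by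
      ext i k
      simp only [Matrix.of_apply]
      rw [← zpow_natCast _ (κ i + (i : ℕ)), inv_zpow', ← zpow_add₀ (hx0 k)]
      congr 1
      rw [← hκ i]
      push_cast
      ring
    rw [this, Matrix.det_mul_row, prod_zpow]
    rfl
  rw [key C (fun i => (ν i : ℤ)) κ (fun i => by exact_mod_cast h i),
    key 0 (fun _ => 0) (fun _ => 0) (fun i => by simp), alt_zero, zero_add]
  have hP : ∏ j, y j ^ 2 ≠ 0 := prod_ne_zero_iff.2 fun j _ => hx0 j
  have hPN := zpow_ne_zero (N : ℤ) hP
  have hV := VV_ne_zero _ hz.inj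
  rw [zpow_add₀ hP]
  field_simp

lemma odd_eq {n : ℕ} (C : ℕ) (ν κ : Fin n → ℕ) (h : ∀ i, κ i + ν i = C) :
    oddColsCount C ν = oc C κ := by
  unfold oddColsCount oc
  refine card_bij' (fun j _ => C - j) (fun t _ => C - t) ?_ ?_ ?_ ?_
  · intro j hj
    simp only [mem_filter, mem_range, mem_Icc] at hj ⊢
    refine ⟨by omega, ?_⟩
    convert hj.2 using 4 with i
    have := h i
    omega
  · intro t ht
    simp only [mem_filter, mem_range, mem_Icc] at ht ⊢
    refine ⟨by omega, ?_⟩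
    convert ht.2 using 4 with i
    have := h i
    omega
  · intro j hj
    simp only [mem_filter, mem_range] at hj
    omega
  · intro t ht
    simp only [mem_filter, mem_Icc] at ht
    omega

lemma schur_sum {F : Type} [Field F] {N : ℕ} (y : Fin (N + 1) → F)
    (h0 : ∀ i, y i ≠ 0) (hz : Good (fun j => (y j ^ 2)⁻¹)) (C p : ℕ) :
    ∑ ν ∈ ((Fintype.piFinset fun _ : Fin (N + 1) => Finset.range (C + 1)).filter
          (fun ν => Antitone ν ∧ oddColsCount C ν = p)),
          schur (fun i => (ν i : ℤ)) (fun j => y j ^ 2)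
      = (∏ j, y j ^ 2) ^ (C : ℤ) * AA C p (fun j => (y j ^ 2)⁻¹) / VV (fun j => (y j ^ 2)⁻¹) := by
  unfold AA
  rw [mul_sum, sum_div]
  refine sum_bij' (fun ν _ i => C - ν i) (fun κ _ i => C - κ i) ?_ ?_ ?_ ?_ ?_
  · intro ν hν
    simp only [mem_filter, Fintype.mem_piFinset, mem_range, Nat.lt_succ_iff] at hν
    obtain ⟨h1, h2, h3⟩ := hν
    rw [mem_idx]
    refine ⟨fun i => Nat.sub_le _ _, fun i j hij => Nat.sub_le_sub_left (h2 hij) _, ?_⟩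
    rw [← odd_eq C ν _ (fun i => Nat.sub_add_cancel (h1 i)), h3]
  · intro κ hκ
    rw [mem_idx] at hκ
    simp only [mem_filter, Fintype.mem_piFinset, mem_range, Nat.lt_succ_iff]
    obtain ⟨h1, h2, h3⟩ := hκ
    refine ⟨fun i => Nat.sub_le _ _, fun i j hij => Nat.sub_le_sub_left (h2 hij) _, ?_⟩
    rw [odd_eq C _ κ (fun i => Nat.add_sub_cancel' (h1 i)), h3]
  · intro ν hν
    simp only [mem_filter, Fintype.mem_piFinset, mem_range, Nat.lt_succ_iff] at hν
    funext i
    exact Nat.sub_sub_self (hν.1 i)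
  · intro κ hκ
    rw [mem_idx] at hκ
    funext i
    exact Nat.sub_sub_self (hκ.1 i)
  · intro ν hν
    simp only [mem_filter, Fintype.mem_piFinset, mem_range, Nat.lt_succ_iff] at hν
    exact schur_side y h0 hz C ν _ (fun i => Nat.sub_add_cancel (hν.1 i))

lemma Xv_ne (n : ℕ) (P Q : MvPolynomial (Fin n) ℚ) (a : Fin n → ℚ)
    (h : MvPolynomial.eval a P ≠ MvPolynomial.eval a Q) :
    algebraMap (MvPolynomial (Fin n) ℚ) (FF n) P ≠ algebraMap (MvPolynomial (Fin n) ℚ) (FF n) Q := by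
  intro e
  exact h (congrArg _ (IsFractionRing.injective (MvPolynomial (Fin n) ℚ) (FF n) e))

lemma Xv_ne_zero (n : ℕ) (i : Fin n) : Xv n i ≠ 0 := by
  have := Xv_ne n (MvPolynomial.X i) 0 (fun _ => 1) (by simp)
  rwa [map_zero] at this

lemma Xv_good (n : ℕ) : Good (fun j => (Xv n j ^ 2)⁻¹) := by
  refine ⟨fun i => inv_ne_zero (pow_ne_zero _ (Xv_ne_zero n i)), ?_, ?_⟩
  · intro i j h
    by_contra hij
    have hh := inv_injective h
    have := Xv_ne n (MvPolynomial.X i ^ 2) (MvPolynomial.X j ^ 2) (fun k => if k = i then 2 else 1)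
      (by simp [Ne.symm hij]; norm_num)
    rw [map_pow, map_pow] at this
    exact this hh
  · intro i j h
    have hh : Xv n i ^ 2 * Xv n j ^ 2 = 1 := by
      rw [← mul_inv, inv_eq_one] at h
      exact h
    have := Xv_ne n (MvPolynomial.X i ^ 2 * MvPolynomial.X j ^ 2) 1 (fun k => 2)
      (by norm_num)
    rw [map_mul, map_pow, map_pow, map_one] at this
    exact this hh

/-- `so_{2n}((c^{n-1}, c-p); x^{±1}) = (x_1⋯x_n)^{-c} ·
∑_{ν ⊆ ((2c)^n), oddcols(((2c)^n)/ν)=p} s_n(ν; x)`; stated in the variables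
`y` with `x_j = y_j²`, where `C = 2c`. -/
theorem soEven_nearly_rectangular_eq_sum_schur
    (n C p : ℕ) (hn : 1 ≤ n) (hp : p ≤ C) :
    soEven n (fun i : Fin n => if (i : ℕ) < n - 1 then (C : ℤ) else (C : ℤ) - 2 * p) (Xv n)
      = (∏ i : Fin n, Xv n i) ^ (-(C : ℤ)) *
        ∑ ν ∈ ((Fintype.piFinset fun _ : Fin n => Finset.range (C + 1)).filter
          (fun ν => Antitone ν ∧ oddColsCount C ν = p)),
          schur (fun i => (ν i : ℤ)) (fun j => Xv n j ^ 2) := by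
  obtain ⟨N, rfl⟩ : ∃ N, n = N + 1 := ⟨n - 1, by omega⟩
  have : CharZero (FF (N + 1)) :=
    charZero_of_injective_algebraMap (R := MvPolynomial (Fin (N + 1)) ℚ)
      (IsFractionRing.injective (MvPolynomial (Fin (N + 1)) ℚ) (FF (N + 1)))
  have h0 := Xv_ne_zero (N + 1)
  rw [soEven_eq (Xv (N + 1)) h0 (Xv_good _) C p hp, schur_sum (Xv (N + 1)) h0 (Xv_good _) C p,
    ← mul_div_assoc, ← mul_assoc]
  congr 2
  have hP : ∏ i, Xv (N + 1) i ≠ 0 := prod_ne_zero_iff.2 fun i _ => h0 i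
  rw [prod_pow, ← zpow_natCast, ← zpow_mul, ← zpow_add₀ hP]
  congr 1
  push_cast
  ring

end
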